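/- Let (Ω₁, 𝒜, μ) and (Ω₂, ℬ, ν) be σ-finite measure spaces with (Ω₁, 𝒜, μ) separable, let u : Ω₂ → ℂ be measurable and let φ : Ω₂ → Ω₁ be measurable and nonsingular. Let p > q ≥ 1, set r = pq/(p−q), define μ_q(A) = ∫_{φ^{-1}(A)} |u|^q dν for A ∈ 𝒜 and F = (dμ_q/dμ)^{1/q}. If the weighted composition operator uC_φ : L^p(μ) → L^q(ν), f ↦ u·(f∘φ), is bounded, then its essential norm equals ‖F·1_{Ω_{1,d}}‖_{L^r(μ)}, where Ω_{1,d} is the diffuse part of Ω₁. -/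

import Mathlib

open MeasureTheory ENNReal

/-- The essential norm of a bounded linear operator: its distance to the compact operators. -/
noncomputable def essNorm {𝕜 X Y : Type*} [NontriviallyNormedField 𝕜]
    [NormedAddCommGroup X] [NormedSpace 𝕜 X] [NormedAddCommGroup Y] [NormedSpace 𝕜 Y]
    (T : X →L[𝕜] Y) : ℝ :=
  sInf ((fun K : X →L[𝕜] Y => ‖T - K‖) '' {K | IsCompactOperator ⇑K})

/-- `μ` is diffuse on `S`: any measurable subset of `S` of positive measure contains
measurable subsets of any smaller measure. -/
def IsDiffuseOn {Ω : Type*} [MeasurableSpace Ω] (μ : Measure Ω) (S : Set Ω) : Prop :=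
  ∀ A : Set Ω, MeasurableSet A → A ⊆ S → 0 < μ A →
    ∀ α : ℝ≥0∞, 0 < α → α < μ A → ∃ A' : Set Ω, MeasurableSet A' ∧ A' ⊆ A ∧ μ A' = α

/-- `A` is an atom of `μ`: a measurable set of positive measure, each of whose measurable
subsets has measure `0` or `μ A`. -/
def IsMeasAtom {Ω : Type*} [MeasurableSpace Ω] (μ : Measure Ω) (A : Set Ω) : Prop :=
  MeasurableSet A ∧ 0 < μ A ∧ ∀ B : Set Ω, MeasurableSet B → B ⊆ A → μ B = 0 ∨ μ B = μ A

/-- `μ` is purely atomic on `S`: `S` is a countable disjoint union of atoms of `μ`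
(some of which may be empty, to allow for finitely many atoms). -/
def IsPurelyAtomicOn {Ω : Type*} [MeasurableSpace Ω] (μ : Measure Ω) (S : Set Ω) : Prop :=
  ∃ A : ℕ → Set Ω, Pairwise (Function.onFun Disjoint A) ∧
    (∀ n, IsMeasAtom μ (A n) ∨ A n = ∅) ∧ S = ⋃ n, A n

/-- The measure space is separable: there is a sequence of measurable sets approximating
every measurable set arbitrarily well in measure of the symmetric difference. -/
def IsSeparableMeasure {Ω : Type*} [MeasurableSpace Ω] (μ : Measure Ω) : Prop :=
  ∃ B : ℕ → Set Ω, (∀ n, MeasurableSet (B n)) ∧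
    ∀ C : Set Ω, MeasurableSet C → ∀ ε : ℝ≥0∞, 0 < ε → ∃ n, μ (symmDiff C (B n)) < ε

theorem Lp_enorm_rpow_eq_lintegral {Ω : Type*} [MeasurableSpace Ω] {μ : Measure Ω} {p : ℝ}
    (hp : 0 < p) (f : Lp ℂ (ENNReal.ofReal p) μ) :
    ‖f‖ₑ ^ p = ∫⁻ y, ‖(f : Ω → ℂ) y‖ₑ ^ p ∂μ := by
  rw [Lp.enorm_def, eLpNorm_eq_lintegral_rpow_enorm_toReal (by simpa using hp) ofReal_ne_top,
    ENNReal.toReal_ofReal hp.le, ← ENNReal.rpow_mul, one_div_mul_cancel hp.ne', ENNReal.rpow_one]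

theorem enorm_rpow_weightedComposition {Ω₁ Ω₂ : Type*} [MeasurableSpace Ω₁] [MeasurableSpace Ω₂]
    {μ : Measure Ω₁} {ν : Measure Ω₂} [SigmaFinite μ] [SigmaFinite ν]
    {u : Ω₂ → ℂ} (hu : Measurable u) {φ : Ω₂ → Ω₁} (hφ : Measurable φ)
    (hns : Measure.map φ ν ≪ μ) {p q : ℝ} (hq : 0 < q)
    (f : Lp ℂ (ENNReal.ofReal p) μ) (g : Lp ℂ (ENNReal.ofReal q) ν)
    (hg : (g : Ω₂ → ℂ) =ᵐ[ν] fun x => u x * (f : Ω₁ → ℂ) (φ x)) :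
    ‖g‖ₑ ^ q = ∫⁻ y, ‖(f : Ω₁ → ℂ) y‖ₑ ^ q *
      (Measure.map φ (ν.withDensity fun x => (‖u x‖₊ : ℝ≥0∞) ^ q)).rnDeriv μ y ∂μ := by
  set κ := Measure.map φ (ν.withDensity fun x => (‖u x‖₊ : ℝ≥0∞) ^ q) with hκ
  have hum : Measurable fun x => (‖u x‖₊ : ℝ≥0∞) ^ q := by fun_prop
  have hfm : Measurable fun y => ‖(f : Ω₁ → ℂ) y‖ₑ ^ q :=
    ((Lp.stronglyMeasurable f).measurable.enorm).pow_const q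
  have hac : κ ≪ μ := ((withDensity_absolutelyContinuous ν _).map hφ).trans hns
  calc ‖g‖ₑ ^ q = ∫⁻ x, (‖u x‖₊ : ℝ≥0∞) ^ q * ‖(f : Ω₁ → ℂ) (φ x)‖ₑ ^ q ∂ν := by
        rw [Lp_enorm_rpow_eq_lintegral hq]
        refine lintegral_congr_ae ?_
        filter_upwards [hg] with x hx
        rw [hx, enorm_mul, ENNReal.mul_rpow_of_nonneg _ _ hq.le, enorm_eq_nnnorm (u x)]
    _ = ∫⁻ y, ‖(f : Ω₁ → ℂ) y‖ₑ ^ q ∂κ := by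
        rw [hκ, lintegral_map hfm hφ]
        exact (lintegral_withDensity_eq_lintegral_mul _ hum (hfm.comp hφ)).symm
    _ = _ := by
        rw [← Measure.withDensity_rnDeriv_eq κ μ hac,
          lintegral_withDensity_eq_lintegral_mul _ (Measure.measurable_rnDeriv _ _) hfm,
          Measure.withDensity_rnDeriv_eq κ μ hac]
        exact lintegral_congr fun y => mul_comm _ _

theorem lintegral_rpow_mul_le_of_lt {Ω : Type*} [MeasurableSpace Ω] (μ : Measure Ω)
    {p q : ℝ} (hq : 0 < q) (hqp : q < p) {g G : Ω → ℝ≥0∞} (hg : Measurable g) (hG : Measurable G) :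
    ∫⁻ y, g y ^ q * G y ∂μ ≤
      (∫⁻ y, G y ^ (p / (p - q)) ∂μ) ^ ((p - q) / p) * (∫⁻ y, g y ^ p ∂μ) ^ (q / p) := by
  have hp : 0 < p := hq.trans hqp
  have hpq : 0 < p - q := sub_pos.2 hqp
  have hconj : (p / q).HolderConjugate (p / (p - q)) := by
    rw [Real.holderConjugate_iff]
    refine ⟨(one_lt_div hq).2 hqp, ?_⟩
    field_simp
    ring
  have := ENNReal.lintegral_mul_le_Lp_mul_Lq μ hconj (f := fun y => g y ^ q) (g := G)
    (hg.pow_const q).aemeasurable hG.aemeasurable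
  simp only [Pi.mul_apply, ← ENNReal.rpow_mul, one_div_div] at this
  rwa [mul_div_cancel₀ _ hq.ne', mul_comm] at this

/-- Testing a weighted norm inequality on truncated powers of the weight bounds the weight. -/
theorem lintegral_weight_le_of_forall_bounded {Ω : Type*} [MeasurableSpace Ω] (μ : Measure Ω)
    [SigmaFinite μ] {p q : ℝ} (hq : 0 < q) (hqp : q < p) {G : Ω → ℝ≥0∞} (hG : Measurable G)
    {S : Set Ω} (hS : MeasurableSet S) {C : ℝ≥0∞}
    (h : ∀ (g : Ω → NNReal) (M : NNReal) (E : Set Ω), Measurable g → (∀ y, g y ≤ M) →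
      MeasurableSet E → E ⊆ S → μ E < ∞ →
      ∫⁻ y in E, (g y : ℝ≥0∞) ^ q * G y ∂μ ≤ C ^ q * (∫⁻ y in E, (g y : ℝ≥0∞) ^ p ∂μ) ^ (q / p)) :
    ∫⁻ y in S, G y ^ (p / (p - q)) ∂μ ≤ C ^ (p * q / (p - q)) := by
  have hp : 0 < p := hq.trans hqp
  have hpq : 0 < p - q := sub_pos.2 hqp
  set E : ℕ → Set Ω := fun n => S ∩ spanningSets μ n with hE
  have hEm : ∀ n, MeasurableSet (E n) := fun n => hS.inter (measurableSet_spanningSets μ n)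
  have hmin : ∀ (n : ℕ) y, min (G y) n ≠ ∞ := fun n y =>
    ((min_le_right _ _).trans_lt (natCast_lt_top n)).ne
  have key : ∀ n : ℕ, ∫⁻ y in E n, min (G y) n ^ (p / (p - q)) ∂μ ≤ C ^ (p * q / (p - q)) := by
    intro n
    set I := ∫⁻ y in E n, min (G y) n ^ (p / (p - q)) ∂μ with hI
    have hEfin : μ (E n) < ∞ :=
      (measure_mono Set.inter_subset_right).trans_lt (measure_spanningSets_lt_top μ n)
    have hIfin : I ≠ ∞ := by
      have : I ≤ ∫⁻ y in E n, (n : ℝ≥0∞) ^ (p / (p - q)) ∂μ :=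
        lintegral_mono fun y => ENNReal.rpow_le_rpow (min_le_right _ _) (by positivity)
      refine (this.trans_lt ?_).ne
      rw [setLIntegral_const]
      exact ENNReal.mul_lt_top (ENNReal.rpow_lt_top_of_nonneg (by positivity) (by simp)) hEfin
    have hcoe : ∀ y, (((min (G y) n).toNNReal ^ (1 / (p - q)) : NNReal) : ℝ≥0∞)
        = min (G y) n ^ (1 / (p - q)) := fun y => by
      rw [ENNReal.coe_rpow_of_nonneg _ (by positivity), ENNReal.coe_toNNReal (hmin n y)]
    have h1 := h (fun y => (min (G y) n).toNNReal ^ (1 / (p - q))) ((n : NNReal) ^ (1 / (p - q)))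
      (E n) (by fun_prop) (fun y => by
        refine NNReal.rpow_le_rpow ?_ (by positivity)
        simpa using ENNReal.toNNReal_mono (natCast_ne_top n) (min_le_right (G y) n)) (hEm n)
      Set.inter_subset_left hEfin
    simp only [hcoe, ← ENNReal.rpow_mul, one_div_mul_eq_div] at h1
    have h2 : I ≤ C ^ q * I ^ (q / p) := by
      refine le_trans (lintegral_mono fun y => ?_) h1
      calc min (G y) n ^ (p / (p - q)) = min (G y) n ^ (q / (p - q)) * min (G y) n := by
            conv_rhs => rw [← ENNReal.rpow_one (min (G y) n), ← ENNReal.rpow_mul, one_mul]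
            rw [← ENNReal.rpow_add_of_nonneg _ _ (by positivity) zero_le_one]
            congr 1
            field_simp
            ring
        _ ≤ _ := by gcongr; exact min_le_left _ _
    rcases eq_or_ne I 0 with h0 | h0
    · rw [h0]; exact zero_le
    · have h3 : I ^ ((p - q) / p) ≤ C ^ q := by
        have hpos : I ^ (q / p) ≠ 0 := by simp [h0, hIfin]
        have hfin : I ^ (q / p) ≠ ∞ := ENNReal.rpow_ne_top_of_nonneg (by positivity) hIfin
        rw [← ENNReal.mul_le_mul_iff_left hpos hfin, ← ENNReal.rpow_add _ _ h0 hIfin]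
        convert h2 using 1
        rw [← add_div, sub_add_cancel, div_self hp.ne', ENNReal.rpow_one]
      have h4 := ENNReal.rpow_le_rpow h3 (z := p / (p - q)) (by positivity)
      rw [← ENNReal.rpow_mul, ← ENNReal.rpow_mul, div_mul_div_cancel₀ hp.ne',
        div_self hpq.ne', ENNReal.rpow_one] at h4
      convert h4 using 2
      ring
  have hlim : ∀ y, Filter.Tendsto (fun n : ℕ =>
      (E n).indicator (fun y => min (G y) n ^ (p / (p - q))) y) Filter.atTop
      (nhds (S.indicator (fun y => G y ^ (p / (p - q))) y)) := by
    intro y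
    by_cases hy : y ∈ S
    · rw [Set.indicator_of_mem hy]
      have ht : Filter.Tendsto (fun n : ℕ => min (G y) n ^ (p / (p - q))) Filter.atTop
          (nhds (G y ^ (p / (p - q)))) := by
        refine (ENNReal.continuous_rpow_const.tendsto _).comp ?_
        simpa using (tendsto_const_nhds (x := G y)).min ENNReal.tendsto_nat_nhds_top
      refine ht.congr' ?_
      filter_upwards [Filter.eventually_ge_atTop (spanningSetsIndex μ y)] with n hn
      rw [Set.indicator_of_mem]
      exact ⟨hy, mem_spanningSets_of_index_le μ y hn⟩
    · rw [Set.indicator_of_notMem hy]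
      refine tendsto_const_nhds.congr fun n => ?_
      rw [Set.indicator_of_notMem fun hh => hy hh.1]
  calc ∫⁻ y in S, G y ^ (p / (p - q)) ∂μ
      = ∫⁻ y, Filter.liminf (fun n : ℕ =>
          (E n).indicator (fun y => min (G y) n ^ (p / (p - q))) y) Filter.atTop ∂μ := by
        rw [← lintegral_indicator hS]
        exact lintegral_congr fun y => (hlim y).liminf_eq.symm
    _ ≤ Filter.liminf (fun n : ℕ => ∫⁻ y,
          (E n).indicator (fun y => min (G y) n ^ (p / (p - q))) y ∂μ) Filter.atTop :=
        lintegral_liminf_le fun n => (by fun_prop : Measurable fun y =>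
          min (G y) n ^ (p / (p - q))).indicator (hEm n)
    _ ≤ C ^ (p * q / (p - q)) := by
        refine Filter.liminf_le_of_le (by isBoundedDefault) fun b hb => ?_
        obtain ⟨n, hn⟩ := hb.exists
        rw [lintegral_indicator (hEm n)] at hn
        exact hn.trans (key n)

theorem IsDiffuseOn.exists_half {Ω : Type*} [MeasurableSpace Ω] {μ : Measure Ω} {S A : Set Ω}
    (h : IsDiffuseOn μ S) (hA : MeasurableSet A) (hAS : A ⊆ S) (hfin : μ A < ∞) :
    ∃ A', MeasurableSet A' ∧ A' ⊆ A ∧ μ A' = μ A / 2 := by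
  rcases eq_or_ne (μ A) 0 with h0 | h0
  · exact ⟨∅, MeasurableSet.empty, Set.empty_subset _, by simp [h0]⟩
  · exact h A hA hAS (pos_iff_ne_zero.2 h0) _ (ENNReal.half_pos h0) (ENNReal.half_lt_self h0 hfin.ne)

/-- Finitely many subsets of a diffuse set of finite measure can be halved simultaneously. -/
theorem IsDiffuseOn.exists_half_forall_mem_finset {Ω : Type*} [MeasurableSpace Ω] {μ : Measure Ω}
    {S E : Set Ω} (h : IsDiffuseOn μ S) (hE : MeasurableSet E) (hES : E ⊆ S) (hfin : μ E < ∞)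
    (s : Finset (Set Ω)) (hs : ∀ A ∈ s, MeasurableSet A ∧ A ⊆ E) :
    ∃ R, MeasurableSet R ∧ R ⊆ E ∧ ∀ A ∈ s, μ (A ∩ R) = μ A / 2 := by
  set F : Set s → Set Ω := fun t => E ∩ ⋂ A : s, {x | x ∈ A.1 ↔ A ∈ t} with hF
  have hFm : ∀ t, MeasurableSet (F t) := fun t => by
    refine hE.inter (MeasurableSet.iInter fun A => ?_)
    by_cases hA : A ∈ t
    · simpa [hA] using (hs A.1 A.2).1
    · have : {x | x ∈ A.1 ↔ A ∈ t} = A.1ᶜ := by ext; simp [hA]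
      exact this ▸ (hs A.1 A.2).1.compl
  have hFd : Pairwise (Function.onFun Disjoint F) := by
    intro t t' htt
    refine Set.disjoint_left.2 fun x hx hx' => htt ?_
    ext A
    exact (Set.mem_iInter.1 hx.2 A).symm.trans (Set.mem_iInter.1 hx'.2 A)
  have hFE : ∀ t, F t ⊆ E := fun t => Set.inter_subset_left
  choose H hHm hHF hHμ using fun t => h.exists_half (hFm t) ((hFE t).trans hES)
    ((measure_mono (hFE t)).trans_lt hfin)
  refine ⟨⋃ t, H t, MeasurableSet.iUnion hHm, Set.iUnion_subset fun t => (hHF t).trans (hFE t),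
    fun A hA => ?_⟩
  have hAm := (hs A hA).1
  have hcover : A = ⋃ t, A ∩ F t := by
    refine Set.Subset.antisymm (fun x hx => ?_) (Set.iUnion_subset fun t => Set.inter_subset_left)
    refine Set.mem_iUnion.2 ⟨{B | x ∈ B.1}, hx, (hs A hA).2 hx, ?_⟩
    simp
  have hAF : μ A = ∑' t, μ (A ∩ F t) := by
    conv_lhs => rw [hcover]
    exact measure_iUnion (fun t t' htt => (hFd htt).mono Set.inter_subset_right
      Set.inter_subset_right) fun t => hAm.inter (hFm t)
  rw [Set.inter_iUnion, measure_iUnion (fun t t' htt => (hFd htt).mono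
      (Set.inter_subset_right.trans (hHF t)) (Set.inter_subset_right.trans (hHF t')))
      fun t => hAm.inter (hHm t), hAF, div_eq_mul_inv, ← ENNReal.tsum_mul_right]
  refine tsum_congr fun t => ?_
  by_cases ht : (⟨A, hA⟩ : s) ∈ t
  · have hsub : F t ⊆ A := fun x hx => (Set.mem_iInter.1 hx.2 ⟨A, hA⟩).2 ht
    rw [Set.inter_eq_right.2 hsub, Set.inter_eq_right.2 ((hHF t).trans hsub), hHμ,
      div_eq_mul_inv]
  · have hempty : A ∩ F t = ∅ := by
      ext x
      simp only [Set.mem_inter_iff, Set.mem_empty_iff_false, iff_false, not_and]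
      exact fun hxA hx => ht ((Set.mem_iInter.1 hx.2 ⟨A, hA⟩).1 hxA)
    have hempty' : A ∩ H t = ∅ :=
      Set.subset_empty_iff.1 (hempty ▸ Set.inter_subset_inter_right A (hHF t))
    simp [hempty, hempty']

/-- A diffuse set of finite measure carries an orthogonal sequence of sign functions. -/
theorem IsDiffuseOn.exists_orthogonal_signs {Ω : Type*} [MeasurableSpace Ω] {μ : Measure Ω}
    {S E : Set Ω} (h : IsDiffuseOn μ S) (hE : MeasurableSet E) (hES : E ⊆ S) (hfin : μ E < ∞) :
    ∃ ε : ℕ → Ω → ℝ, (∀ n, Measurable (ε n)) ∧ (∀ n x, |ε n x| = 1) ∧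
      ∀ m n, m ≠ n → ∫ x in E, ε m x * ε n x ∂μ = 0 := by
  obtain ⟨A, hA, hAA⟩ := exists_seq_of_forall_finset_exists
    (fun A : Set Ω => MeasurableSet A ∧ A ⊆ E ∧ μ A = μ E / 2)
    (fun A B => μ (A ∩ B) = μ A / 2) (by
      intro s hs
      obtain ⟨R, hR, hRE, hRs⟩ := h.exists_half_forall_mem_finset hE hES hfin (insert E s) (by
        intro A hA
        rcases Finset.mem_insert.1 hA with rfl | hA
        · exact ⟨hE, subset_rfl⟩
        · exact ⟨(hs A hA).1, (hs A hA).2.1⟩)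
      refine ⟨R, ⟨hR, hRE, ?_⟩, fun A hA => hRs A (Finset.mem_insert_of_mem hA)⟩
      simpa [Set.inter_eq_right.2 hRE] using hRs E (Finset.mem_insert_self _ _))
  have : IsFiniteMeasure (μ.restrict E) := ⟨by simpa using hfin⟩
  set ε : ℕ → Ω → ℝ := fun n x => 2 * (A n).indicator (fun _ => 1) x - 1 with hε
  have hreal : ∀ n, (μ.restrict E).real (A n) = (μ.restrict E).real Set.univ / 2 := fun n => by
    simp [Measure.real, Measure.restrict_apply (hA n).1, Set.inter_eq_left.2 (hA n).2.1,
      (hA n).2.2]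
  have hlt : ∀ m n, m < n → ∫ x in E, ε m x * ε n x ∂μ = 0 := by
    intro m n hmn
    have hintble : ∀ B, MeasurableSet B → Integrable (B.indicator fun _ => (1 : ℝ)) (μ.restrict E) :=
      fun B hB => (integrable_const 1).indicator hB
    have hI : (μ.restrict E).real (A m ∩ A n) = (μ.restrict E).real (A m) / 2 := by
      simp [Measure.real, Measure.restrict_apply (hA m).1, Set.inter_eq_left.2 (hA m).2.1,
        Measure.restrict_apply ((hA m).1.inter (hA n).1),
        Set.inter_eq_left.2 (Set.inter_subset_left.trans (hA m).2.1 : A m ∩ A n ⊆ E), hAA m n hmn]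
    have hexp : ∀ x, ε m x * ε n x = 4 * (A m ∩ A n).indicator (fun _ => (1 : ℝ)) x
        - 2 * (A m).indicator (fun _ => 1) x - 2 * (A n).indicator (fun _ => 1) x + 1 := by
      intro x
      by_cases h1 : x ∈ A m <;> by_cases h2 : x ∈ A n <;> simp [hε, h1, h2] <;> norm_num
    simp_rw [hexp]
    have i1 := (hintble _ ((hA m).1.inter (hA n).1)).const_mul 4
    have i2 := (hintble _ (hA m).1).const_mul 2
    have i3 := (hintble _ (hA n).1).const_mul 2
    have i12 := i1.sub i2
    have i123 := i12.sub i3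
    simp only [Pi.sub_def] at i12 i123
    rw [integral_add i123 (integrable_const 1), integral_sub i12 i3, integral_sub i1 i2,
      integral_const_mul, integral_const_mul, integral_const_mul,
      integral_indicator_const _ ((hA m).1.inter (hA n).1), integral_indicator_const _ (hA m).1,
      integral_indicator_const _ (hA n).1, integral_const, hI, hreal m, hreal n]
    simp only [smul_eq_mul]
    ring
  refine ⟨ε, fun n => ?_, fun n x => ?_, fun m n hmn => ?_⟩
  · exact ((measurable_const.indicator (hA n).1).const_mul 2).sub_const 1
  · by_cases hx : x ∈ A n <;> simp [hε, hx]; norm_num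
  · rcases hmn.lt_or_gt with h1 | h1
    · exact hlt m n h1
    · rw [← hlt n m h1]
      simp_rw [mul_comm]

theorem integral_sq_sum_of_orthogonal_signs {Ω : Type*} [MeasurableSpace Ω] (μ : Measure Ω)
    [IsFiniteMeasure μ] {ε : ℕ → Ω → ℝ} (hm : ∀ n, Measurable (ε n)) (h1 : ∀ n x, |ε n x| = 1)
    (horth : ∀ m n, m ≠ n → ∫ x, ε m x * ε n x ∂μ = 0) (N : ℕ) :
    ∫ x, (∑ i ∈ Finset.range N, ε i x) ^ 2 ∂μ = N * μ.real Set.univ := by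
  have hintble : ∀ i j, Integrable (fun x => ε i x * ε j x) μ := fun i j =>
    Integrable.of_bound ((hm i).mul (hm j)).aestronglyMeasurable 1
      (Filter.Eventually.of_forall fun x => by simp [h1])
  simp_rw [sq, Finset.sum_mul_sum]
  rw [integral_finsetSum _ fun i _ => integrable_finsetSum _ fun j _ => hintble i j]
  simp_rw [integral_finsetSum _ fun j (_ : j ∈ Finset.range N) => hintble _ j]
  have : ∀ i ∈ Finset.range N, ∑ j ∈ Finset.range N, ∫ x, ε i x * ε j x ∂μ
      = μ.real Set.univ := by
    intro i hi
    rw [Finset.sum_eq_single_of_mem i hi fun j _ hj => horth i j hj.symm]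
    have : ∀ x, ε i x * ε i x = 1 := fun x => by rw [← abs_mul_abs_self, h1, one_mul]
    simp [this]
  rw [Finset.sum_congr rfl this]
  simp

/-- Cesàro means of an orthogonal sequence of sign functions tend to zero in `L^p`. -/
theorem tendsto_lintegral_cesaro_of_orthogonal_signs {Ω : Type*} [MeasurableSpace Ω]
    (μ : Measure Ω) [IsFiniteMeasure μ] {ε : ℕ → Ω → ℝ} (hm : ∀ n, Measurable (ε n))
    (h1 : ∀ n x, |ε n x| = 1) (horth : ∀ m n, m ≠ n → ∫ x, ε m x * ε n x ∂μ = 0)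
    {p : ℝ} (hp : 0 < p) :
    Filter.Tendsto (fun N : ℕ =>
      ∫⁻ x, ‖(N : ℝ)⁻¹ * ∑ i ∈ Finset.range N, ε i x‖ₑ ^ p ∂μ) Filter.atTop (nhds 0) := by
  set a : ℕ → Ω → ℝ := fun N x => (N : ℝ)⁻¹ * ∑ i ∈ Finset.range N, ε i x with ha
  have ham : ∀ N, Measurable (a N) := fun N => by
    have := Finset.measurable_sum (Finset.range N) fun i _ => hm i
    fun_prop
  have ha1 : ∀ N x, |a N x| ≤ 1 := fun N x => by
    rw [ha, abs_mul, abs_inv, Nat.abs_cast]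
    refine inv_mul_le_one_of_le₀ ?_ N.cast_nonneg
    refine (Finset.abs_sum_le_sum_abs _ _).trans ?_
    simp [h1]
  have hintble : ∀ N, Integrable (fun x => |a N x| ^ p) μ := fun N =>
    Integrable.of_bound ((ham N).abs.pow_const p).aestronglyMeasurable 1
      (Filter.Eventually.of_forall fun x => by
      rw [Real.norm_of_nonneg (by positivity)]
      exact Real.rpow_le_one (abs_nonneg _) (ha1 N x) hp.le)
  have hint2 : ∀ N, Integrable (fun x => (a N x) ^ 2) μ := fun N =>
    Integrable.of_bound (by have := ham N; fun_prop) 1 (Filter.Eventually.of_forall fun x => by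
      rw [Real.norm_of_nonneg (by positivity), ← sq_abs]
      exact pow_le_one₀ (abs_nonneg _) (ha1 N x))
  have hsq : ∀ N : ℕ, N ≠ 0 → ∫ x, (a N x) ^ 2 ∂μ = μ.real Set.univ * (N : ℝ)⁻¹ := by
    intro N hN
    simp_rw [ha, mul_pow]
    rw [integral_const_mul, integral_sq_sum_of_orthogonal_signs μ hm h1 horth]
    field_simp
  have hbound : ∀ N : ℕ, N ≠ 0 → ∫ x, |a N x| ^ p ∂μ ≤
      μ.real Set.univ * (N : ℝ) ^ (-(p / 4)) + μ.real Set.univ * (N : ℝ) ^ (-(1 / 2 : ℝ)) := by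
    intro N hN
    have hN' : (0 : ℝ) < N := by positivity
    have hpt : ∀ x, |a N x| ^ p ≤ (N : ℝ) ^ (-(p / 4)) + (N : ℝ) ^ (1 / 2 : ℝ) * (a N x) ^ 2 := by
      intro x
      rcases le_or_gt |a N x| ((N : ℝ) ^ (-(1 / 4) : ℝ)) with hx | hx
      · have := Real.rpow_le_rpow (abs_nonneg _) hx hp.le
        rw [← Real.rpow_mul hN'.le] at this
        have h3 : -(1 / 4) * p = -(p / 4) := by ring
        rw [h3] at this
        have : 0 ≤ (N : ℝ) ^ (1 / 2 : ℝ) * (a N x) ^ 2 := by positivity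
        linarith
      · have h2 : |a N x| ^ p ≤ 1 := Real.rpow_le_one (abs_nonneg _) (ha1 N x) hp.le
        have h3 : ((N : ℝ) ^ (-(1 / 4) : ℝ)) ^ 2 ≤ (a N x) ^ 2 := by
          rw [← sq_abs (a N x)]
          gcongr
        have h4 : (N : ℝ) ^ (1 / 2 : ℝ) * ((N : ℝ) ^ (-(1 / 4) : ℝ)) ^ 2 = 1 := by
          rw [← Real.rpow_natCast, ← Real.rpow_mul hN'.le, ← Real.rpow_add hN']
          norm_num
        have h5 : 1 ≤ (N : ℝ) ^ (1 / 2 : ℝ) * (a N x) ^ 2 := by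
          exact h4.symm.trans_le (mul_le_mul_of_nonneg_left h3 (by positivity))
        have : 0 ≤ (N : ℝ) ^ (-(p / 4)) := by positivity
        linarith
    have hi := (integrable_const (μ := μ) ((N : ℝ) ^ (-(p / 4)))).add
      ((hint2 N).const_mul ((N : ℝ) ^ (1 / 2 : ℝ)))
    simp only [Pi.add_def] at hi
    refine (integral_mono (hintble N) hi hpt).trans ?_
    rw [integral_add (integrable_const _) ((hint2 N).const_mul _), integral_const_mul, hsq N hN,
      integral_const, smul_eq_mul]
    refine le_of_eq ?_
    congr 1
    rw [mul_left_comm]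
    congr 1
    rw [← Real.rpow_neg_one, ← Real.rpow_add hN']
    norm_num
  have hlim : Filter.Tendsto (fun N : ℕ => ∫ x, |a N x| ^ p ∂μ) Filter.atTop (nhds 0) := by
    have h2 : Filter.Tendsto (fun N : ℕ => μ.real Set.univ * (N : ℝ) ^ (-(p / 4))
        + μ.real Set.univ * (N : ℝ) ^ (-(1 / 2 : ℝ))) Filter.atTop (nhds 0) := by
      have t1 := ((tendsto_rpow_neg_atTop (y := p / 4) (by positivity)).comp
        tendsto_natCast_atTop_atTop).const_mul (μ.real Set.univ)
      have t2 := ((tendsto_rpow_neg_atTop (y := 1 / 2) (by positivity)).comp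
        tendsto_natCast_atTop_atTop).const_mul (μ.real Set.univ)
      simpa using t1.add t2
    refine tendsto_of_tendsto_of_tendsto_of_le_of_le' tendsto_const_nhds h2
      (Filter.Eventually.of_forall fun N => integral_nonneg fun x => by positivity) ?_
    filter_upwards [Filter.eventually_ne_atTop 0] with N hN using hbound N hN
  have := ENNReal.tendsto_ofReal hlim
  rw [ENNReal.ofReal_zero] at this
  refine this.congr fun N => ?_
  rw [ofReal_integral_eq_lintegral_ofReal (hintble N)
    (Filter.Eventually.of_forall fun x => by positivity)]
  refine lintegral_congr fun x => ?_
  rw [← ENNReal.ofReal_rpow_of_nonneg (abs_nonneg _) hp.le, ← Real.enorm_eq_ofReal_abs]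

/-- A compact operator maps some subsequence to a null sequence as soon as the Cesàro means of
all subsequences are null. -/
theorem IsCompactOperator.exists_strictMono_tendsto_zero {X Y : Type*}
    [NormedAddCommGroup X] [NormedSpace ℂ X] [NormedAddCommGroup Y] [NormedSpace ℂ Y]
    {K : X →L[ℂ] Y} (hK : IsCompactOperator ⇑K) {x : ℕ → X} {M : ℝ} (hx : ∀ n, ‖x n‖ ≤ M)
    (hces : ∀ σ : ℕ → ℕ, StrictMono σ → Filter.Tendsto
      (fun N : ℕ => (N : ℂ)⁻¹ • ∑ i ∈ Finset.range N, x (σ i)) Filter.atTop (nhds 0)) :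
    ∃ σ : ℕ → ℕ, StrictMono σ ∧
      Filter.Tendsto (fun n => K (x (σ n))) Filter.atTop (nhds 0) := by
  obtain ⟨Q, hQ, hKQ⟩ :=
    IsCompactOperator.image_closedBall_subset_compact (f := (K : X →ₗ[ℂ] Y)) hK M
  obtain ⟨y, -, σ, hσ, hy⟩ := hQ.tendsto_subseq (x := fun n => K (x n))
    fun n => hKQ ⟨x n, by simpa using hx n, rfl⟩
  refine ⟨σ, hσ, ?_⟩
  have h1 := hy.cesaro_smul
  have h2 : Filter.Tendsto (fun N : ℕ => K ((N : ℂ)⁻¹ • ∑ i ∈ Finset.range N, x (σ i)))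
      Filter.atTop (nhds 0) := by
    have := (K.continuous.tendsto 0).comp (hces σ hσ)
    rwa [map_zero] at this
  have h3 : y = 0 := by
    refine tendsto_nhds_unique h1 (h2.congr fun N => ?_)
    rw [map_smul, map_sum, RCLike.real_smul_eq_coe_smul (K := ℂ)]
    simp
  rwa [h3] at hy

theorem lintegral_enorm_rpow_mul_of_ae_eq_indicator {Ω : Type*} [MeasurableSpace Ω]
    {μ : Measure Ω} {E : Set Ω} (hE : MeasurableSet E) {f h : Ω → ℂ}
    (hf : f =ᵐ[μ] E.indicator h) {q : ℝ} (hq : 0 < q) (W : Ω → ℝ≥0∞) :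
    ∫⁻ y, ‖f y‖ₑ ^ q * W y ∂μ = ∫⁻ y in E, ‖h y‖ₑ ^ q * W y ∂μ := by
  rw [← lintegral_indicator hE]
  refine lintegral_congr_ae ?_
  filter_upwards [hf] with y hy
  by_cases hyE : y ∈ E <;> simp [hy, hyE, hq]

theorem Lp_enorm_rpow_of_ae_eq_indicator {Ω : Type*} [MeasurableSpace Ω]
    {μ : Measure Ω} {p : ℝ} (hp : 0 < p) {E : Set Ω} (hE : MeasurableSet E) {h : Ω → ℂ}
    {f : Lp ℂ (ENNReal.ofReal p) μ} (hf : (f : Ω → ℂ) =ᵐ[μ] E.indicator h) :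
    ‖f‖ₑ ^ p = ∫⁻ y in E, ‖h y‖ₑ ^ p ∂μ := by
  simpa [Lp_enorm_rpow_eq_lintegral hp] using
    lintegral_enorm_rpow_mul_of_ae_eq_indicator hE hf hp fun _ => 1

theorem exists_Lp_ae_eq_indicator {Ω : Type*} [MeasurableSpace Ω] {μ : Measure Ω} (p : ℝ≥0∞)
    {E : Set Ω} (hE : MeasurableSet E) (hfin : μ E < ∞) {h : Ω → ℂ} (hm : Measurable h) {M : ℝ}
    (hM : ∀ y, ‖h y‖ ≤ M) : ∃ f : Lp ℂ p μ, (f : Ω → ℂ) =ᵐ[μ] E.indicator h := by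
  have : IsFiniteMeasure (μ.restrict E) := ⟨by simpa using hfin⟩
  have hmem : MemLp (E.indicator h) p μ := (memLp_indicator_iff_restrict hE).2
    (MemLp.of_bound hm.aestronglyMeasurable M (Filter.Eventually.of_forall hM))
  exact ⟨hmem.toLp _, hmem.coeFn_toLp⟩

theorem lintegral_weight_le_opNorm {Ω Y : Type*} [MeasurableSpace Ω] {μ : Measure Ω}
    [NormedAddCommGroup Y] [NormedSpace ℂ Y] {p q : ℝ} [Fact ((1 : ℝ≥0∞) ≤ ENNReal.ofReal p)]
    (hp : 0 < p) (hq : 0 < q) {G : Ω → ℝ≥0∞} {T : Lp ℂ (ENNReal.ofReal p) μ →L[ℂ] Y}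
    (hT : ∀ f, ‖T f‖ₑ ^ q = ∫⁻ y, ‖(f : Ω → ℂ) y‖ₑ ^ q * G y ∂μ)
    {g : Ω → NNReal} {M : NNReal} {E : Set Ω} (hg : Measurable g) (hgM : ∀ y, g y ≤ M)
    (hE : MeasurableSet E) (hfin : μ E < ∞) :
    ∫⁻ y in E, (g y : ℝ≥0∞) ^ q * G y ∂μ ≤
      ‖T‖ₑ ^ q * (∫⁻ y in E, (g y : ℝ≥0∞) ^ p ∂μ) ^ (q / p) := by
  obtain ⟨f, hf⟩ := exists_Lp_ae_eq_indicator (ENNReal.ofReal p) hE hfin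
    (h := fun y => ((g y : ℝ) : ℂ)) (by fun_prop) (M := M) fun y => by simpa using hgM y
  have hn : ∀ y, ‖((g y : ℝ) : ℂ)‖ₑ = g y := fun y => by simp [enorm_eq_nnnorm]
  have h1 := Lp_enorm_rpow_of_ae_eq_indicator hp hE hf
  have h2 := (hT f).trans (lintegral_enorm_rpow_mul_of_ae_eq_indicator hE hf hq G)
  simp only [hn] at h1 h2
  rw [← h1, ← h2, ← ENNReal.rpow_mul, mul_div_cancel₀ _ hp.ne',
    ← ENNReal.mul_rpow_of_nonneg _ _ hq.le]
  exact ENNReal.rpow_le_rpow (T.le_opENorm f) hq.le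

theorem lintegral_weight_le_opNorm_sub_compact {Ω Y : Type*} [MeasurableSpace Ω] {μ : Measure Ω}
    [NormedAddCommGroup Y] [NormedSpace ℂ Y] {p q : ℝ} [Fact ((1 : ℝ≥0∞) ≤ ENNReal.ofReal p)]
    (hp : 0 < p) (hq : 0 < q) {G : Ω → ℝ≥0∞} {T K : Lp ℂ (ENNReal.ofReal p) μ →L[ℂ] Y}
    (hT : ∀ f, ‖T f‖ₑ ^ q = ∫⁻ y, ‖(f : Ω → ℂ) y‖ₑ ^ q * G y ∂μ) (hK : IsCompactOperator ⇑K)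
    {S : Set Ω} (hS : IsDiffuseOn μ S)
    {g : Ω → NNReal} {M : NNReal} {E : Set Ω} (hg : Measurable g) (hgM : ∀ y, g y ≤ M)
    (hE : MeasurableSet E) (hES : E ⊆ S) (hfin : μ E < ∞) :
    ∫⁻ y in E, (g y : ℝ≥0∞) ^ q * G y ∂μ ≤
      ‖T - K‖ₑ ^ q * (∫⁻ y in E, (g y : ℝ≥0∞) ^ p ∂μ) ^ (q / p) := by
  have : IsFiniteMeasure (μ.restrict E) := ⟨by simpa using hfin⟩
  obtain ⟨ε, hεm, hε1, hεo⟩ := hS.exists_orthogonal_signs hE hES hfin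
  have hex : ∀ n, ∃ f : Lp ℂ (ENNReal.ofReal p) μ,
      (f : Ω → ℂ) =ᵐ[μ] E.indicator fun y => ((g y * ε n y : ℝ) : ℂ) := fun n =>
    exists_Lp_ae_eq_indicator _ hE hfin (by have := hεm n; fun_prop) (M := M) fun y => by
      simpa [hε1] using hgM y
  choose x hx using hex
  have hn : ∀ n y, ‖((g y * ε n y : ℝ) : ℂ)‖ₑ = g y := fun n y => by
    have : ‖((g y * ε n y : ℝ) : ℂ)‖ = (g y : ℝ) := by simp [hε1]
    rw [← ofReal_norm, this, ENNReal.ofReal_coe_nnreal]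
  have hxp : ∀ n, ‖x n‖ₑ ^ p = ∫⁻ y in E, (g y : ℝ≥0∞) ^ p ∂μ := fun n => by
    simpa only [hn] using Lp_enorm_rpow_of_ae_eq_indicator hp hE (hx n)
  have hTx : ∀ n, ‖T (x n)‖ₑ ^ q = ∫⁻ y in E, (g y : ℝ≥0∞) ^ q * G y ∂μ := fun n => by
    simpa only [hn] using
      (hT (x n)).trans (lintegral_enorm_rpow_mul_of_ae_eq_indicator hE (hx n) hq G)
  have hxc : ∀ n, ‖x n‖ₑ = ‖x 0‖ₑ := fun n =>
    (ENNReal.rpow_left_injective hp.ne') ((hxp n).trans (hxp 0).symm)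
  have hTc : ∀ n, ‖T (x n)‖ₑ = ‖T (x 0)‖ₑ := fun n =>
    (ENNReal.rpow_left_injective hq.ne') ((hTx n).trans (hTx 0).symm)
  have hces : ∀ σ : ℕ → ℕ, StrictMono σ → Filter.Tendsto
      (fun N : ℕ => (N : ℂ)⁻¹ • ∑ i ∈ Finset.range N, x (σ i)) Filter.atTop (nhds 0) := by
    intro σ hσ
    have hae : ∀ N : ℕ, (((N : ℂ)⁻¹ • ∑ i ∈ Finset.range N, x (σ i) :
        Lp ℂ (ENNReal.ofReal p) μ) : Ω → ℂ) =ᵐ[μ] E.indicator fun y =>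
          ((g y * ((N : ℝ)⁻¹ * ∑ i ∈ Finset.range N, ε (σ i) y) : ℝ) : ℂ) := by
      intro N
      have hall : ∀ᵐ y ∂μ, ∀ i, (x (σ i) : Ω → ℂ) y =
          E.indicator (fun y => ((g y * ε (σ i) y : ℝ) : ℂ)) y :=
        ae_all_iff.2 fun i => hx (σ i)
      filter_upwards [Lp.coeFn_smul (N : ℂ)⁻¹ (∑ i ∈ Finset.range N, x (σ i)),
        Lp.coeFn_fun_finsetSum (Finset.range N) fun i => x (σ i), hall] with y h1 h2 h3
      rw [h1, Pi.smul_apply, h2]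
      simp only [h3]
      by_cases hyE : y ∈ E
      · simp only [Set.indicator_of_mem hyE, smul_eq_mul]
        push_cast
        rw [← Finset.mul_sum]
        ring
      · simp [hyE]
    have hle : ∀ N : ℕ, ‖(N : ℂ)⁻¹ • ∑ i ∈ Finset.range N, x (σ i)‖ₑ ^ p ≤ (M : ℝ≥0∞) ^ p *
        ∫⁻ y in E, ‖(N : ℝ)⁻¹ * ∑ i ∈ Finset.range N, ε (σ i) y‖ₑ ^ p ∂μ := by
      intro N
      have hm : Measurable fun y => ‖(N : ℝ)⁻¹ * ∑ i ∈ Finset.range N, ε (σ i) y‖ₑ ^ p := by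
        have := Finset.measurable_sum (Finset.range N) fun i _ => hεm (σ i)
        fun_prop
      rw [Lp_enorm_rpow_of_ae_eq_indicator hp hE (hae N), ← lintegral_const_mul _ hm]
      refine lintegral_mono fun y => ?_
      rw [← ENNReal.mul_rpow_of_nonneg _ _ hp.le]
      refine ENNReal.rpow_le_rpow ?_ hp.le
      rw [Complex.ofReal_mul, enorm_mul]
      have h1 : ‖((g y : ℝ) : ℂ)‖ₑ = g y := by simp [enorm_eq_nnnorm]
      have h2 : ∀ t : ℝ, ‖(t : ℂ)‖ₑ = ‖t‖ₑ := fun t => by simp [enorm_eq_nnnorm]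
      rw [h1, h2]
      gcongr
      exact hgM y
    have hlim := tendsto_lintegral_cesaro_of_orthogonal_signs (μ.restrict E)
      (fun n => hεm (σ n)) (fun n => hε1 (σ n))
      (fun m n hmn => hεo _ _ fun h => hmn (hσ.injective h)) hp
    have hlim2 := ENNReal.Tendsto.const_mul hlim (a := (M : ℝ≥0∞) ^ p)
      (Or.inr (ENNReal.rpow_ne_top_of_nonneg hp.le coe_ne_top))
    rw [mul_zero] at hlim2
    have hlim3 := tendsto_of_tendsto_of_tendsto_of_le_of_le tendsto_const_nhds hlim2
      (fun _ => zero_le) hle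
    have hlim4 := hlim3.ennrpow_const (1 / p)
    simp only [← ENNReal.rpow_mul, mul_one_div_cancel hp.ne', ENNReal.rpow_one] at hlim4
    rw [ENNReal.zero_rpow_of_pos (by positivity)] at hlim4
    exact tendsto_zero_iff_enorm_tendsto_zero.2 hlim4
  obtain ⟨σ, hσ, hlim⟩ := hK.exists_strictMono_tendsto_zero (M := ‖x 0‖)
    (fun n => (enorm_le_iff_norm_le.1 (hxc n).le)) hces
  have hmain : ‖T (x 0)‖ₑ ≤ ‖T - K‖ₑ * ‖x 0‖ₑ := by
    have hlim' : Filter.Tendsto (fun n => ‖T - K‖ₑ * ‖x 0‖ₑ + ‖K (x (σ n))‖ₑ) Filter.atTop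
        (nhds (‖T - K‖ₑ * ‖x 0‖ₑ + 0)) :=
      tendsto_const_nhds.add (tendsto_zero_iff_enorm_tendsto_zero.1 hlim)
    rw [add_zero] at hlim'
    refine ge_of_tendsto' hlim' fun n => ?_
    calc ‖T (x 0)‖ₑ = ‖(T - K) (x (σ n)) + K (x (σ n))‖ₑ := by simp [hTc]
      _ ≤ ‖(T - K) (x (σ n))‖ₑ + ‖K (x (σ n))‖ₑ := enorm_add_le _ _
      _ ≤ _ := by
        gcongr
        rw [← hxc (σ n)]
        exact (T - K).le_opENorm _
  rw [← hTx 0, ← hxp 0, ← ENNReal.rpow_mul, mul_div_cancel₀ _ hp.ne',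
    ← ENNReal.mul_rpow_of_nonneg _ _ hq.le]
  exact ENNReal.rpow_le_rpow hmain hq.le

/-- Multiplication by the indicator function of `B`, as an operator on `L^p`. -/
noncomputable def LpCutoff {Ω : Type*} [MeasurableSpace Ω] (μ : Measure Ω) (p : ℝ≥0∞)
    [Fact (1 ≤ p)] (B : Set Ω) (hB : MeasurableSet B) : Lp ℂ p μ →L[ℂ] Lp ℂ p μ :=
  LinearMap.mkContinuous
    { toFun := fun f => ((Lp.memLp f).indicator hB).toLp _
      map_add' := fun f g => by
        rw [← MemLp.toLp_add]
        refine MemLp.toLp_congr _ _ ?_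
        filter_upwards [Lp.coeFn_add f g] with y hy
        by_cases h : y ∈ B
        · rw [Pi.add_apply, Set.indicator_of_mem h, Set.indicator_of_mem h, Set.indicator_of_mem h,
            hy, Pi.add_apply]
        · simp [h]
      map_smul' := fun c f => by
        rw [RingHom.id_apply, ← MemLp.toLp_const_smul]
        refine MemLp.toLp_congr _ _ ?_
        filter_upwards [Lp.coeFn_smul c f] with y hy
        by_cases h : y ∈ B
        · rw [Pi.smul_apply, Set.indicator_of_mem h, Set.indicator_of_mem h, hy, Pi.smul_apply]
        · simp [h] }
    1 fun f => by
      rw [one_mul]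
      refine Lp.norm_le_norm_of_ae_le ?_
      filter_upwards [((Lp.memLp f).indicator hB).coeFn_toLp] with y hy
      exact hy ▸ norm_indicator_le_norm_self _ _

theorem LpCutoff_ae_eq {Ω : Type*} [MeasurableSpace Ω] {μ : Measure Ω} {p : ℝ≥0∞}
    [Fact (1 ≤ p)] {B : Set Ω} (hB : MeasurableSet B) (f : Lp ℂ p μ) :
    (LpCutoff μ p B hB f : Ω → ℂ) =ᵐ[μ] B.indicator f :=
  ((Lp.memLp f).indicator hB).coeFn_toLp

theorem LpCutoff_add_of_disjoint {Ω : Type*} [MeasurableSpace Ω] {μ : Measure Ω} {p : ℝ≥0∞}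
    [Fact (1 ≤ p)] {A B : Set Ω} (hA : MeasurableSet A) (hB : MeasurableSet B)
    (hAB : Disjoint A B) :
    LpCutoff μ p (A ∪ B) (hA.union hB) = LpCutoff μ p A hA + LpCutoff μ p B hB := by
  ext1 f
  refine Lp.ext ?_
  filter_upwards [LpCutoff_ae_eq (hA.union hB) f, LpCutoff_ae_eq hA f, LpCutoff_ae_eq hB f,
    Lp.coeFn_add (LpCutoff μ p A hA f) (LpCutoff μ p B hB f)] with y h1 h2 h3 h4
  rw [add_apply, h4, Pi.add_apply, h1, h2, h3,
    Set.indicator_union_of_disjoint hAB]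

theorem LpCutoff_univ {Ω : Type*} [MeasurableSpace Ω] {μ : Measure Ω} {p : ℝ≥0∞}
    [Fact (1 ≤ p)] : LpCutoff μ p Set.univ MeasurableSet.univ = ContinuousLinearMap.id ℂ _ := by
  ext1 f
  refine Lp.ext ?_
  filter_upwards [LpCutoff_ae_eq MeasurableSet.univ f] with y h1
  simpa using h1

theorem norm_comp_LpCutoff_le {Ω Y : Type*} [MeasurableSpace Ω] {μ : Measure Ω}
    [NormedAddCommGroup Y] [NormedSpace ℂ Y] {p q : ℝ} [Fact ((1 : ℝ≥0∞) ≤ ENNReal.ofReal p)]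
    (hq : 0 < q) (hqp : q < p) {G : Ω → ℝ≥0∞} (hG : Measurable G)
    {T : Lp ℂ (ENNReal.ofReal p) μ →L[ℂ] Y}
    (hT : ∀ f, ‖T f‖ₑ ^ q = ∫⁻ y, ‖(f : Ω → ℂ) y‖ₑ ^ q * G y ∂μ)
    {B : Set Ω} (hB : MeasurableSet B) (hfin : ∫⁻ y in B, G y ^ (p / (p - q)) ∂μ ≠ ∞) :
    ‖T.comp (LpCutoff μ _ B hB)‖ ≤
      ((∫⁻ y in B, G y ^ (p / (p - q)) ∂μ) ^ ((p - q) / (p * q))).toReal := by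
  have hp : 0 < p := hq.trans hqp
  have hpq : 0 < p - q := sub_pos.2 hqp
  refine ContinuousLinearMap.opNorm_le_bound _ ENNReal.toReal_nonneg fun f => ?_
  set I := ∫⁻ y in B, G y ^ (p / (p - q)) ∂μ with hI
  have h1 : ‖T (LpCutoff μ _ B hB f)‖ₑ ^ q ≤ I ^ ((p - q) / p) * (‖f‖ₑ ^ p) ^ (q / p) := by
    rw [hT, lintegral_enorm_rpow_mul_of_ae_eq_indicator hB (LpCutoff_ae_eq hB f) hq]
    refine (lintegral_rpow_mul_le_of_lt _ hq hqp
      (Lp.stronglyMeasurable f).measurable.enorm hG).trans ?_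
    rw [Lp_enorm_rpow_eq_lintegral hp]
    gcongr
    exact Measure.restrict_le_self
  have h2 := ENNReal.rpow_le_rpow h1 (z := 1 / q) (by positivity)
  have hexp : p * (q / p * (1 / q)) = 1 := by field_simp
  rw [ENNReal.mul_rpow_of_nonneg _ _ (by positivity), ← ENNReal.rpow_mul, ← ENNReal.rpow_mul,
    ← ENNReal.rpow_mul, ← ENNReal.rpow_mul, mul_one_div_cancel hq.ne', ENNReal.rpow_one,
    hexp, ENNReal.rpow_one, div_mul_div_comm, mul_one] at h2
  have hfin' : I ^ ((p - q) / (p * q)) ≠ ∞ := ENNReal.rpow_ne_top_of_nonneg (by positivity) hfin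
  have h3 := ENNReal.toReal_mono (ENNReal.mul_ne_top hfin' enorm_ne_top) h2
  rwa [ENNReal.toReal_mul, toReal_enorm, toReal_enorm] at h3

theorem IsMeasAtom.measure_lt_top {Ω : Type*} [MeasurableSpace Ω] {μ : Measure Ω} [SigmaFinite μ]
    {A : Set Ω} (hA : IsMeasAtom μ A) : μ A < ∞ := by
  by_contra h
  have htop : μ A = ∞ := not_lt_top_iff.1 h
  have hzero : ∀ n, μ (A ∩ spanningSets μ n) = 0 := fun n => by
    refine (hA.2.2 _ (hA.1.inter (measurableSet_spanningSets μ n))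
      Set.inter_subset_left).resolve_right fun heq => ?_
    exact ((measure_mono Set.inter_subset_right).trans_lt
      (measure_spanningSets_lt_top μ n)).ne (heq.trans htop)
  have hcover : A = ⋃ n, A ∩ spanningSets μ n := by
    rw [← Set.inter_iUnion, iUnion_spanningSets, Set.inter_univ]
  have := measure_iUnion_null hzero
  rw [← hcover] at this
  exact hA.2.1.ne' this

/-- A measurable function is almost everywhere constant on an atom. -/
theorem IsMeasAtom.exists_ae_eq_const {Ω : Type*} [MeasurableSpace Ω] {μ : Measure Ω}
    [SigmaFinite μ] {A : Set Ω} (hA : IsMeasAtom μ A) {f : Ω → ℂ} (hf : Measurable f) :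
    ∃ c : ℂ, f =ᵐ[μ.restrict A] Function.const Ω c := by
  refine Filter.exists_eventuallyEq_const_of_forall_separating MeasurableSet fun U hU => ?_
  have hU' := hf hU
  rcases hA.2.2 (A ∩ f ⁻¹' U) (hA.1.inter hU') Set.inter_subset_left with h | h
  · right
    have hset : {a | ¬ f a ∉ U} = f ⁻¹' U := by ext; simp
    change μ.restrict A {a | ¬ f a ∉ U} = 0
    rwa [hset, Measure.restrict_apply hU', Set.inter_comm]
  · left
    rw [ae_iff, Measure.restrict_apply (by exact hU'.compl)]
    have h2 := measure_sdiff (μ := μ) (Set.inter_subset_left : A ∩ f ⁻¹' U ⊆ A)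
      (hA.1.inter hU').nullMeasurableSet (h.trans_lt hA.measure_lt_top).ne
    rw [h, tsub_self, Set.sdiff_self_inter] at h2
    rwa [Set.inter_comm]

theorem IsMeasAtom.isCompactOperator_LpCutoff {Ω : Type*} [MeasurableSpace Ω] {μ : Measure Ω}
    [SigmaFinite μ] {p : ℝ≥0∞} [Fact (1 ≤ p)] {A : Set Ω} (hA : IsMeasAtom μ A) :
    IsCompactOperator ⇑(LpCutoff μ p A hA.1) := by
  set e : Lp ℂ p μ := indicatorConstLp p hA.1 hA.measure_lt_top.ne 1 with he
  have he_ae : (e : Ω → ℂ) =ᵐ[μ] A.indicator fun _ => 1 := indicatorConstLp_coeFn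
  have hcut : ∀ f : Lp ℂ p μ, ∃ c : ℂ, LpCutoff μ p A hA.1 f = c • e := by
    intro f
    obtain ⟨c, hc⟩ := hA.exists_ae_eq_const (Lp.stronglyMeasurable f).measurable
    refine ⟨c, Lp.ext ?_⟩
    filter_upwards [LpCutoff_ae_eq hA.1 f, Lp.coeFn_smul c e, he_ae,
      (ae_restrict_iff' hA.1).1 hc] with y h1 h2 h3 h4
    rw [h1, h2, Pi.smul_apply, h3]
    by_cases hy : y ∈ A
    · simpa [hy] using h4 hy
    · simp [hy]
  have he0 : e ≠ 0 := by
    intro h0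
    have h1 : A.indicator (fun _ => (1 : ℂ)) =ᵐ[μ] 0 :=
      he_ae.symm.trans (h0 ▸ Lp.coeFn_zero ℂ p μ)
    have h2 : μ A = 0 := by
      simpa [Set.indicator_ae_eq_zero, Function.support_const] using h1
    exact hA.2.1.ne' h2
  have hepos : 0 < ‖e‖ := norm_pos_iff.2 he0
  refine ⟨(fun c : ℂ => c • e) '' Metric.closedBall 0 (‖LpCutoff μ p A hA.1‖ / ‖e‖),
    (isCompact_closedBall _ _).image (by fun_prop), ?_⟩
  filter_upwards [Metric.ball_mem_nhds (0 : Lp ℂ p μ) one_pos] with f hf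
  obtain ⟨c, hc⟩ := hcut f
  refine ⟨c, ?_, hc.symm⟩
  rw [mem_closedBall_zero_iff, le_div_iff₀ hepos, ← norm_smul, ← hc]
  exact (LpCutoff μ p A hA.1).unit_le_opNorm f (mem_ball_zero_iff.1 hf).le

theorem IsPurelyAtomicOn.isCompactOperator_comp_LpCutoff {Ω Y : Type*} [MeasurableSpace Ω]
    {μ : Measure Ω} [SigmaFinite μ] [NormedAddCommGroup Y] [NormedSpace ℂ Y] [CompleteSpace Y]
    {p q : ℝ} [Fact ((1 : ℝ≥0∞) ≤ ENNReal.ofReal p)]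
    (hq : 0 < q) (hqp : q < p) {G : Ω → ℝ≥0∞} (hG : Measurable G)
    {T : Lp ℂ (ENNReal.ofReal p) μ →L[ℂ] Y}
    (hT : ∀ f, ‖T f‖ₑ ^ q = ∫⁻ y, ‖(f : Ω → ℂ) y‖ₑ ^ q * G y ∂μ)
    (hfin : ∫⁻ y, G y ^ (p / (p - q)) ∂μ ≠ ∞)
    {S : Set Ω} (hS : MeasurableSet S) (hat : IsPurelyAtomicOn μ S) :
    IsCompactOperator ⇑(T.comp (LpCutoff μ _ S hS)) := by
  obtain ⟨A, hAd, hAat, hSA⟩ := hat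
  have hp : 0 < p := hq.trans hqp
  have hpq : 0 < p - q := sub_pos.2 hqp
  have hAm : ∀ n, MeasurableSet (A n) := fun n =>
    (hAat n).elim (fun h => h.1) fun h => h ▸ MeasurableSet.empty
  set B : ℕ → Set Ω := fun n => ⋃ k < n, A k with hB
  have hBm : ∀ n, MeasurableSet (B n) := fun n =>
    MeasurableSet.iUnion fun k => MeasurableSet.iUnion fun _ => hAm k
  have hBS : ∀ n, B n ⊆ S := fun n => by
    rw [hSA]
    exact Set.iUnion₂_subset fun k _ => Set.subset_iUnion A k
  have hzero : ∀ h0 : MeasurableSet (∅ : Set Ω),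
      LpCutoff μ (ENNReal.ofReal p) ∅ h0 = 0 := fun h0 => by
    ext1 f
    refine Lp.ext ?_
    filter_upwards [LpCutoff_ae_eq h0 f, Lp.coeFn_zero ℂ (ENNReal.ofReal p) μ] with y h1 h2
    rw [h1, zero_apply, h2]
    simp
  have hatom : ∀ n, IsCompactOperator ⇑(LpCutoff μ (ENNReal.ofReal p) (A n) (hAm n)) := fun n => by
    rcases hAat n with h | h
    · exact h.isCompactOperator_LpCutoff
    · simp only [h, hzero]
      exact isCompactOperator_zero
  have hpart : ∀ n, IsCompactOperator ⇑(LpCutoff μ (ENNReal.ofReal p) (B n) (hBm n)) := by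
    intro n
    induction n with
    | zero =>
      have : B 0 = ∅ := by simp [hB]
      simp only [this, hzero]
      exact isCompactOperator_zero
    | succ n ih =>
      have hsucc : B (n + 1) = B n ∪ A n := Set.biUnion_lt_succ A n
      have hdisj : Disjoint (B n) (A n) := by
        simp only [hB, Set.disjoint_iUnion_left]
        exact fun k hk => hAd hk.ne
      simp only [hsucc, LpCutoff_add_of_disjoint (hBm n) (hAm n) hdisj]
      exact ih.add (hatom n)
  set κ := μ.withDensity fun y => G y ^ (p / (p - q)) with hκ
  have hκfin : κ Set.univ ≠ ∞ := by simpa [hκ] using hfin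
  have hdiffm : ∀ n, MeasurableSet (S \ B n) := fun n => hS.diff (hBm n)
  have hκlim : Filter.Tendsto (fun n => κ (S \ B n)) Filter.atTop (nhds 0) := by
    have hanti : Antitone fun n => S \ B n := fun m n hmn =>
      Set.sdiff_subset_sdiff_right (Set.biUnion_mono (fun k (hk : k < m) => hk.trans_le hmn)
        fun _ _ => subset_rfl)
    have hinter : ⋂ n, S \ B n = ∅ := by
      refine Set.eq_empty_of_forall_notMem fun y hy => ?_
      have hyS : y ∈ S := (Set.mem_iInter.1 hy 0).1
      obtain ⟨k, hk⟩ := Set.mem_iUnion.1 (hSA ▸ hyS)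
      exact (Set.mem_iInter.1 hy (k + 1)).2 (Set.mem_biUnion (Nat.lt_succ_self k) hk)
    have := tendsto_measure_iInter_atTop (μ := κ) (fun n => (hdiffm n).nullMeasurableSet) hanti
      ⟨0, ((measure_mono (Set.subset_univ _)).trans_lt hκfin.lt_top).ne⟩
    rwa [hinter, measure_empty] at this
  refine isCompactOperator_of_tendsto (l := Filter.atTop)
    (F := fun n => T.comp (LpCutoff μ (ENNReal.ofReal p) (B n) (hBm n))) ?_
    (Filter.Eventually.of_forall fun n => (hpart n).clm_comp T)
  rw [tendsto_iff_norm_sub_tendsto_zero]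
  have hbound : ∀ n, ‖T.comp (LpCutoff μ (ENNReal.ofReal p) (B n) (hBm n)) -
      T.comp (LpCutoff μ _ S hS)‖ ≤ (κ (S \ B n) ^ ((p - q) / (p * q))).toReal := by
    intro n
    have hSB : LpCutoff μ (ENNReal.ofReal p) S hS = LpCutoff μ _ (B n) (hBm n) +
        LpCutoff μ _ (S \ B n) (hdiffm n) := by
      rw [← LpCutoff_add_of_disjoint (hBm n) (hdiffm n) Set.disjoint_sdiff_right]
      congr 1
      exact (Set.union_sdiff_cancel (hBS n)).symm
    have hset : κ (S \ B n) = ∫⁻ y in S \ B n, G y ^ (p / (p - q)) ∂μ :=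
      withDensity_apply _ (hdiffm n)
    rw [hSB, ContinuousLinearMap.comp_add, sub_add_cancel_left, norm_neg, hset]
    refine norm_comp_LpCutoff_le hq hqp hG hT (hdiffm n) ?_
    rw [← hset]
    exact ((measure_mono (Set.subset_univ _)).trans_lt hκfin.lt_top).ne
  have hlim : Filter.Tendsto (fun n => (κ (S \ B n) ^ ((p - q) / (p * q))).toReal)
      Filter.atTop (nhds 0) := by
    have h1 := hκlim.ennrpow_const ((p - q) / (p * q))
    rw [ENNReal.zero_rpow_of_pos (by positivity)] at h1
    have h2 := (ENNReal.tendsto_toReal zero_ne_top).comp h1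
    rwa [ENNReal.toReal_zero] at h2
  exact squeeze_zero (fun n => norm_nonneg _) hbound hlim

/-- Essential norm of a weighted composition operator `uC_φ : L^p(μ) → L^q(ν)`, `p > q ≥ 1`:
with `μ_q(A) = ∫_{φ⁻¹(A)} |u|^q dν`, `F = (dμ_q/dμ)^{1/q}` and `r = pq/(p−q)`, if `uC_φ` is
bounded then its essential norm equals `‖F·1_{Ω_{1,d}}‖_{L^r(μ)}`, where `Ω_{1,d}` is the
diffuse part of `Ω₁`. -/
theorem essNorm_weightedComposition {Ω₁ Ω₂ : Type*}
    [MeasurableSpace Ω₁] [MeasurableSpace Ω₂]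
    (μ : Measure Ω₁) (ν : Measure Ω₂) [SigmaFinite μ] [SigmaFinite ν]
    (hsep : IsSeparableMeasure μ)
    (Ωd Ωa : Set Ω₁) (hΩd : MeasurableSet Ωd) (hΩa : MeasurableSet Ωa)
    (hdisj : Disjoint Ωd Ωa) (hunion : Ωd ∪ Ωa = Set.univ)
    (hdiffuse : IsDiffuseOn μ Ωd) (hatomic : IsPurelyAtomicOn μ Ωa)
    (u : Ω₂ → ℂ) (hu : Measurable u)
    (φ : Ω₂ → Ω₁) (hφ : Measurable φ) (hns : Measure.map φ ν ≪ μ)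
    (p q r : ℝ) [Fact ((1:ℝ≥0∞) ≤ ENNReal.ofReal p)] [Fact ((1:ℝ≥0∞) ≤ ENNReal.ofReal q)]
    (hq : 1 ≤ q) (hqp : q < p) (hr : r = p * q / (p - q))
    (T : Lp ℂ (ENNReal.ofReal p) μ →L[ℂ] Lp ℂ (ENNReal.ofReal q) ν)
    (hT : ∀ f : Lp ℂ (ENNReal.ofReal p) μ,
      (T f : Ω₂ → ℂ) =ᵐ[ν] fun x => u x * (f : Ω₁ → ℂ) (φ x)) :
    essNorm T
      = ((∫⁻ y in Ωd,
            (((Measure.map φ (ν.withDensity fun x => (‖u x‖₊ : ℝ≥0∞) ^ q)).rnDeriv μ y)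
              ^ (1/q)) ^ r ∂μ) ^ (1/r)).toReal := by
  have hq0 : 0 < q := one_pos.trans_le hq
  have hp0 : 0 < p := hq0.trans hqp
  have hpq : 0 < p - q := sub_pos.2 hqp
  set G := (Measure.map φ (ν.withDensity fun x => (‖u x‖₊ : ℝ≥0∞) ^ q)).rnDeriv μ with hGdef
  have hG : Measurable G := Measure.measurable_rnDeriv _ _
  have hTG : ∀ f, ‖T f‖ₑ ^ q = ∫⁻ y, ‖(f : Ω₁ → ℂ) y‖ₑ ^ q * G y ∂μ := fun f =>
    enorm_rpow_weightedComposition hu hφ hns hq0 f (T f) (hT f)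
  have hexp : 1 / q * r = p / (p - q) := by
    rw [hr]
    field_simp
  have hexp' : 1 / r = (p - q) / (p * q) := by rw [hr, one_div_div]
  have hr0 : 0 < r := by rw [hr]; positivity
  simp only [← ENNReal.rpow_mul, hexp]
  have hfin : ∫⁻ y, G y ^ (p / (p - q)) ∂μ ≠ ∞ := by
    have h := lintegral_weight_le_of_forall_bounded μ hq0 hqp hG MeasurableSet.univ (C := ‖T‖ₑ)
      fun g M E hg hgM hE _ hEfin => lintegral_weight_le_opNorm hp0 hq0 hTG hg hgM hE hEfin
    rw [setLIntegral_univ] at h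
    exact (h.trans_lt (ENNReal.rpow_lt_top_of_nonneg (hr ▸ hr0.le) enorm_ne_top)).ne
  have hfind : ∫⁻ y in Ωd, G y ^ (p / (p - q)) ∂μ ≠ ∞ :=
    ((setLIntegral_le_lintegral _ _).trans_lt hfin.lt_top).ne
  refine le_antisymm ?_ ?_
  · refine csInf_le_of_le ⟨0, ?_⟩
      ⟨_, hatomic.isCompactOperator_comp_LpCutoff hq0 hqp hG hTG hfin hΩa, rfl⟩ ?_
    · rintro _ ⟨K, -, rfl⟩
      exact norm_nonneg _
    · have hsplit : T = T.comp (LpCutoff μ _ Ωd hΩd) + T.comp (LpCutoff μ _ Ωa hΩa) := by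
        rw [← ContinuousLinearMap.comp_add, ← LpCutoff_add_of_disjoint hΩd hΩa hdisj]
        simp only [hunion, LpCutoff_univ, ContinuousLinearMap.comp_id]
      have hsub : T - T.comp (LpCutoff μ _ Ωa hΩa) = T.comp (LpCutoff μ _ Ωd hΩd) :=
        sub_eq_of_eq_add hsplit
      rw [hexp']
      simp only [hsub]
      exact norm_comp_LpCutoff_le hq0 hqp hG hTG hΩd hfind
  · refine le_csInf ⟨_, 0, isCompactOperator_zero, rfl⟩ ?_
    rintro _ ⟨K, hK, rfl⟩
    have h := lintegral_weight_le_of_forall_bounded μ hq0 hqp hG hΩd (C := ‖T - K‖ₑ)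
      fun g M E hg hgM hE hES hEfin =>
        lintegral_weight_le_opNorm_sub_compact hp0 hq0 hTG hK hdiffuse hg hgM hE hES hEfin
    have h2 := ENNReal.rpow_le_rpow h (z := 1 / r) (by positivity)
    rw [← hr, ← ENNReal.rpow_mul, mul_one_div_cancel hr0.ne', ENNReal.rpow_one] at h2
    have h3 := ENNReal.toReal_mono enorm_ne_top h2
    rwa [toReal_enorm] at h3
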